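/- arXiv:1702.05534 — 2 statements merged into one kernel-verified Lean document; each statement's English description precedes it below -/
import Mathlib

section
/- For all a, b ∈ ℂ such that a+b is not zero or a negative integer, and for every z ∈ ℂ, the product of the two entire Kummer series satisfies (∑_{p≥0} (a)_p/((a+b)_p · p!) (iz)^p) · (∑_{p≥0} (a)_p/((a+b)_p · p!) (−iz)^p) = ∑_{n≥0} (−1)^n · (a)_n (b)_n / ((a+b)_n (a+b)_{2n} · n!) · z^{2n}, where all three series converge absolutely. -/
/-- The Pochhammer symbol `(x)_n = x(x+1)⋯(x+n-1)` over `ℂ`. -/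
noncomputable def poch (x : ℂ) (n : ℕ) : ℂ := (ascPochhammer ℂ n).eval x


open PowerSeries in
theorem kp_coeff (a b c : ℂ) (hb : a + b = c) (hc : ∀ k : ℕ, c + (k : ℂ) ≠ 0)
    (F : ℕ → ℂ) (hF : ∀ n : ℕ, ((n : ℂ) + 1) * (c + n) * F (n + 1) = (a + n) * F n)
    (m : ℕ) :
    ((m : ℂ) + 1) * (c + m) * (c + 2 * m) * (c + 2 * m + 1) *
      coeff (2 * m + 2) (PowerSeries.mk F * PowerSeries.mk (fun n => (-1) ^ n * F n)) =
    (a + m) * (b + m) *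
      coeff (2 * m) (PowerSeries.mk F * PowerSeries.mk (fun n => (-1) ^ n * F n)) := by
  set f : PowerSeries ℂ := PowerSeries.mk F with hf
  set g : PowerSeries ℂ := PowerSeries.mk (fun n => (-1) ^ n * F n) with hg
  set f1 := derivative ℂ f with hf1
  set g1 := derivative ℂ g with hg1
  set f2 := derivative ℂ f1 with hf2
  set g2 := derivative ℂ g1 with hg2
  have k0 : ∀ h : PowerSeries ℂ, constantCoeff (derivative ℂ h) = coeff 1 h := by
    intro h
    rw [← coeff_zero_eq_constantCoeff_apply, coeff_derivative]; simp
  have ef : X * f2 = (X - C c) * f1 + C a * f := by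
    ext n
    rcases n with _ | n
    · have := hF 0
      simp [sub_mul, hf2, hf1, hf, k0] at this ⊢
      linear_combination this
    · have := hF (n + 1)
      simp [sub_mul, hf2, hf1, hf, coeff_derivative, coeff_succ_X_mul] at this ⊢
      linear_combination this
  have eg : X * g2 = -((X + C c) * g1) - C a * g := by
    ext n
    rcases n with _ | n
    · have := hF 0
      simp [add_mul, hg2, hg1, hg, k0] at this ⊢
      linear_combination -this
    · have := hF (n + 1)
      simp [add_mul, hg2, hg1, hg, coeff_derivative, coeff_succ_X_mul] at this ⊢
      ring_nf at this ⊢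
      linear_combination (-1) ^ n * this
  set u := f * g with hu
  set s := f1 * g + f * g1 with hs
  set d := f1 * g - f * g1 with hd
  set y := f1 * g1 with hy
  have e1 : derivative ℂ u = s := by
    rw [hu, hs, Derivation.leibniz]; simp only [smul_eq_mul]; ring
  have e2 : X * derivative ℂ s = C 2 * (X * y) + X * d - C c * s := by
    rw [hs, map_add, Derivation.leibniz, Derivation.leibniz]; simp only [smul_eq_mul]
    rw [← hf2, ← hg2, ← hf1, ← hg1, show (C 2 : PowerSeries ℂ) = 2 from rfl]
    linear_combination g * ef + f * eg
  have e3 : X * derivative ℂ d = X * s + C 2 * (C a * u) - C c * d := by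
    rw [hd, map_sub, Derivation.leibniz, Derivation.leibniz]; simp only [smul_eq_mul]
    rw [← hf2, ← hg2, ← hf1, ← hg1, show (C 2 : PowerSeries ℂ) = 2 from rfl]
    linear_combination g * ef - f * eg
  have e4 : X * derivative ℂ y = - (C 2 * (C c * y)) - C a * d := by
    rw [hy, Derivation.leibniz]; simp only [smul_eq_mul]
    rw [← hf2, ← hg2, show (C 2 : PowerSeries ℂ) = 2 from rfl]
    linear_combination g1 * ef + f1 * eg
  have cX : ∀ (h : PowerSeries ℂ) (n : ℕ), coeff n (X * derivative ℂ h) = n * coeff n h := by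
    intro h n
    rcases n with _ | n
    · simp
    · rw [coeff_succ_X_mul, coeff_derivative]; push_cast; ring
  have c1 : coeff (2 * m + 1) s = (2 * m + 2) * coeff (2 * m + 2) u := by
    rw [← e1, coeff_derivative]; push_cast; ring
  have c1' : coeff (2 * m) (X * s) = 2 * m * coeff (2 * m) u := by
    rw [← e1, cX]; push_cast; ring
  have c2 := congrArg (coeff (2 * m + 1)) e2
  have c3 := congrArg (coeff (2 * m)) e3
  have c4 := congrArg (coeff (2 * m)) e4
  rw [cX] at c2 c3 c4
  simp only [map_add, map_sub, map_neg, coeff_C_mul, coeff_succ_X_mul, c1'] at c2 c3 c4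
  rw [c1] at c2
  push_cast at c2 c3 c4
  have hcb : b = c - a := by rw [← hb]; ring
  subst hcb
  linear_combination (1/2) * (c + m) * (c + 2 * m) * c2 + (1/2) * (c - a + m) * c3 +
    (1/2) * (c + 2 * m) * c4

theorem poch_succ (x : ℂ) (n : ℕ) : poch x (n + 1) = poch x n * (x + n) := by
  simp [poch, ascPochhammer_succ_eval]

theorem poch_ne (c : ℂ) (hc : ∀ k : ℕ, c + (k : ℂ) ≠ 0) (n : ℕ) : poch c n ≠ 0 := by
  induction n with
  | zero => simp [poch]
  | succ n ih => rw [poch_succ]; exact mul_ne_zero ih (hc n)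

theorem kp_rec (a c : ℂ) (hc : ∀ k : ℕ, c + (k : ℂ) ≠ 0) (n : ℕ) :
    ((n : ℂ) + 1) * (c + n) * (poch a (n+1) / (poch c (n+1) * ((n+1).factorial : ℂ))) =
      (a + n) * (poch a n / (poch c n * (n.factorial : ℂ))) := by
  have h1 := poch_ne c hc n
  have h2 := hc n
  have h3 : (n.factorial : ℂ) ≠ 0 := by exact_mod_cast n.factorial_ne_zero
  have h4 : (n : ℂ) + 1 ≠ 0 := by exact_mod_cast n.succ_ne_zero
  rw [poch_succ, poch_succ, Nat.factorial_succ]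
  push_cast
  field_simp

theorem kp_even (a b c : ℂ) (hb : a + b = c) (hc : ∀ k : ℕ, c + (k : ℂ) ≠ 0) (m : ℕ) :
    PowerSeries.coeff (2 * m) (PowerSeries.mk (fun p => poch a p / (poch c p * (p.factorial : ℂ)))
      * PowerSeries.mk (fun n => (-1) ^ n * (poch a n / (poch c n * (n.factorial : ℂ))))) =
    poch a m * poch b m / (poch c m * poch c (2 * m) * (m.factorial : ℂ)) := by
  induction m with
  | zero => simp [poch]
  | succ m ih =>
    have key := kp_coeff a b c hb hc
      (fun p => poch a p / (poch c p * (p.factorial : ℂ))) (kp_rec a c hc) m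
    rw [ih] at key
    have h1 := poch_ne c hc m
    have h1' := poch_ne c hc (2 * m)
    have h2 := hc m
    have h3 : (m.factorial : ℂ) ≠ 0 := by exact_mod_cast m.factorial_ne_zero
    have h4 : (m : ℂ) + 1 ≠ 0 := by exact_mod_cast m.succ_ne_zero
    have h5 : c + 2 * m ≠ 0 := by have := hc (2 * m); push_cast at this; exact this
    have h6 : c + 2 * m + 1 ≠ 0 := by
      have := hc (2 * m + 1); push_cast at this; rwa [← add_assoc] at this
    have h7 : ((m : ℂ) + 1) * (c + m) * (c + 2 * m) * (c + 2 * m + 1) ≠ 0 := by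
      simp only [ne_eq, mul_eq_zero, not_or]; exact ⟨⟨⟨h4, h2⟩, h5⟩, h6⟩
    apply mul_left_cancel₀ h7
    rw [show 2 * (m + 1) = 2 * m + 2 by ring, key, poch_succ a, poch_succ b, poch_succ c m,
      poch_succ c (2 * m + 1), poch_succ c (2 * m), Nat.factorial_succ]
    push_cast
    rw [← add_assoc c]
    rw [mul_comm (2 : ℂ) (m : ℂ)] at h5 h6
    field_simp

theorem kp_odd (F : ℕ → ℂ) (N : ℕ) (hN : Odd N) :
    PowerSeries.coeff N (PowerSeries.mk F * PowerSeries.mk (fun n => (-1) ^ n * F n)) = 0 := by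
  have h : PowerSeries.coeff N (PowerSeries.mk F * PowerSeries.mk (fun n => (-1) ^ n * F n)) =
      - PowerSeries.coeff N (PowerSeries.mk F * PowerSeries.mk (fun n => (-1) ^ n * F n)) := by
    conv_lhs => rw [mul_comm]
    rw [PowerSeries.coeff_mul, PowerSeries.coeff_mul, ← Finset.sum_neg_distrib]
    apply Finset.sum_congr rfl
    rintro ⟨p, q⟩ hpq
    simp only [Finset.HasAntidiagonal.mem_antidiagonal] at hpq
    simp only [PowerSeries.coeff_mk]
    have : (-1 : ℂ) ^ p = - (-1) ^ q := by
      rcases Nat.even_or_odd q with hq | hq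
      · have hp : Odd p := by subst hpq; exact (Nat.odd_add.mp hN).mpr hq
        rw [hp.neg_one_pow, hq.neg_one_pow]
      · have hp : Even p := by
          subst hpq
          rw [← Nat.not_odd_iff_even]
          intro h
          exact (Nat.not_even_iff_odd.mpr hq) ((Nat.odd_add.mp hN).mp h)
        rw [hp.neg_one_pow, hq.neg_one_pow]; ring
    rw [this]; ring
  exact self_eq_neg.mp h

open Filter Topology in
theorem kp_summable (a c : ℂ) (hc : ∀ k : ℕ, c + (k : ℂ) ≠ 0) (x : ℂ) :
    Summable (fun p : ℕ => poch a p / (poch c p * (Nat.factorial p : ℂ)) * x ^ p) := by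
  have t1 := tendsto_add_mul_div_add_mul_atTop_nhds a c (1 : ℂ) (d := 1) one_ne_zero
  have t2 : Tendsto (fun k : ℕ => 1 / ((k : ℂ) + 1)) atTop (𝓝 0) :=
    tendsto_one_div_add_atTop_nhds_zero_nat (𝕜 := ℂ)
  have t3 := ((t1.mul t2).mul_const x).norm
  simp only [mul_zero, zero_mul, norm_zero] at t3
  have ev := t3.eventually (gt_mem_nhds (show (0 : ℝ) < 1 / 2 by norm_num))
  refine summable_of_ratio_norm_eventually_le (r := 1 / 2) (by norm_num) ?_
  filter_upwards [ev] with n hn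
  have h4 : (n : ℂ) + 1 ≠ 0 := by exact_mod_cast n.succ_ne_zero
  have h2 := hc n
  have hr := kp_rec a c hc n
  have : poch a (n+1) / (poch c (n+1) * (Nat.factorial (n+1) : ℂ)) * x ^ (n+1) =
      ((a + 1 * n) / (c + 1 * n) * (1 / ((n : ℂ) + 1)) * x) *
      (poch a n / (poch c n * (Nat.factorial n : ℂ)) * x ^ n) := by
    have h8 : poch a (n+1) / (poch c (n+1) * (Nat.factorial (n+1) : ℂ)) =
      (a + n) * (poch a n / (poch c n * (n.factorial : ℂ))) / (((n : ℂ) + 1) * (c + n)) := by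
      rw [← hr]; field_simp
    rw [h8, pow_succ, one_mul]
    field_simp
  rw [this, norm_mul]
  exact mul_le_mul_of_nonneg_right hn.le (norm_nonneg _)

/-- Ramanujan–Preece product formula for `₁F₁(a;a+b;iz) · ₁F₁(a;a+b;−iz)`. -/
theorem kummer_product (a b : ℂ) (hab : ∀ k : ℕ, a + b + (k : ℂ) ≠ 0) (z : ℂ) :
    Summable (fun p : ℕ =>
      poch a p / (poch (a + b) p * (Nat.factorial p : ℂ)) * (Complex.I * z) ^ p) ∧
    Summable (fun p : ℕ =>
      poch a p / (poch (a + b) p * (Nat.factorial p : ℂ)) * (-Complex.I * z) ^ p) ∧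
    Summable (fun n : ℕ => (-1 : ℂ) ^ n * (poch a n * poch b n) /
      (poch (a + b) n * poch (a + b) (2 * n) * (Nat.factorial n : ℂ)) * z ^ (2 * n)) ∧
    (∑' p : ℕ, poch a p / (poch (a + b) p * (Nat.factorial p : ℂ)) * (Complex.I * z) ^ p) *
      (∑' p : ℕ, poch a p / (poch (a + b) p * (Nat.factorial p : ℂ)) * (-Complex.I * z) ^ p) =
    ∑' n : ℕ, (-1 : ℂ) ^ n * (poch a n * poch b n) /
      (poch (a + b) n * poch (a + b) (2 * n) * (Nat.factorial n : ℂ)) * z ^ (2 * n) := by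
  have h1 := kp_summable a (a + b) hab (Complex.I * z)
  have h2 := kp_summable a (a + b) hab (-Complex.I * z)
  set F : ℕ → ℂ := fun p => poch a p / (poch (a + b) p * (Nat.factorial p : ℂ)) with hF
  set u : ℕ → ℂ := fun N => PowerSeries.coeff N
    (PowerSeries.mk F * PowerSeries.mk (fun n => (-1) ^ n * F n)) with hu
  have hN : ∀ N, (∑ kl ∈ Finset.HasAntidiagonal.antidiagonal N,
      F kl.1 * (Complex.I * z) ^ kl.1 * (F kl.2 * (-Complex.I * z) ^ kl.2)) =
      u N * (Complex.I * z) ^ N := by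
    intro N
    simp only [hu]
    rw [PowerSeries.coeff_mul, Finset.sum_mul]
    apply Finset.sum_congr rfl
    rintro ⟨p, q⟩ hpq
    simp only [Finset.HasAntidiagonal.mem_antidiagonal] at hpq
    simp only [PowerSeries.coeff_mk]
    rw [← hpq, pow_add, neg_mul, neg_pow (Complex.I * z) q]
    ring
  have hs := summable_norm_sum_mul_antidiagonal_of_summable_norm h1.norm h2.norm
  have ht := tsum_mul_tsum_eq_tsum_sum_antidiagonal_of_summable_norm h1.norm h2.norm
  have hs' : Summable (fun N => u N * (Complex.I * z) ^ N) := by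
    have := hs.of_norm
    refine this.congr ?_
    intro N
    exact hN N
  have ht' := ht.trans (tsum_congr hN)
  have inj : Function.Injective (fun n : ℕ => 2 * n) := fun m n h => by
    simp only at h
    omega
  have he : ∀ n : ℕ, u (2 * n) * (Complex.I * z) ^ (2 * n) =
      (-1 : ℂ) ^ n * (poch a n * poch b n) /
      (poch (a + b) n * poch (a + b) (2 * n) * (Nat.factorial n : ℂ)) * z ^ (2 * n) := by
    intro n
    simp only [hu, hF]
    rw [kp_even a b (a + b) rfl hab n, mul_pow, pow_mul Complex.I, Complex.I_sq]
    ring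
  refine ⟨h1, h2, ?_, ?_⟩
  · exact (hs'.comp_injective inj).congr he
  · refine ht'.trans ?_
    rw [← tsum_congr he]
    refine (inj.tsum_eq (f := fun N => u N * (Complex.I * z) ^ N) ?_).symm
    intro N hNs
    rcases Nat.even_or_odd N with h | h
    · obtain ⟨k, hk⟩ := h
      exact ⟨k, by simp only; omega⟩
    · exfalso
      apply hNs
      simp only [hu]
      rw [kp_odd F N h, zero_mul]
end

section
/- Let ν ∈ ℂ with ν not equal to any negative integer, and let z : ℕ≥1 → ℂ be a sequence of nonzero complex numbers such that (k ↦ 1/z_k²) is summable and, for every t ∈ ℂ, ∏_{k≥1} (1 − t²/z_k²) = ∑_{m≥0} (−1)^m/(m! (ν+1)_m) · (t/2)^{2m}. Then for every n ≥ 0, the Bessel multiple zeta value ζ_{B,ν}({4}^n) := ∑_{k₁>k₂>⋯>k_n≥1} ∏_{i=1}^n 1/z_{k_i}⁴ equals 1/(2^{4n} · n! · (ν+1)_{2n} · (ν+1)_n). -/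
/-- The multiple zeta value `ζ_z({s}^n) = ∑_{k₁ > ⋯ > k_n} ∏ᵢ 1/z_{kᵢ}^s`. -/
noncomputable def mzv (z : ℕ → ℂ) (s n : ℕ) : ℂ :=
  ∑' f : {f : Fin n → ℕ // StrictAnti f}, ∏ i, 1 / (z (f.1 i)) ^ s

open Filter Topology in
/-- Uniqueness of power series coefficients. -/
theorem coeff_unique (p q : ℕ → ℂ) (f : ℂ → ℂ) (hp : ∀ x : ℂ, HasSum (fun n => x ^ n * p n) (f x))
    (hq : ∀ x : ℂ, HasSum (fun n => x ^ n * q n) (f x)) : p = q := by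
  have h1 : HasFPowerSeriesAt f (FormalMultilinearSeries.ofScalars ℂ p) 0 := by
    rw [hasFPowerSeriesAt_iff]
    exact Eventually.of_forall fun x => by simpa using hp x
  have h2 : HasFPowerSeriesAt f (FormalMultilinearSeries.ofScalars ℂ q) 0 := by
    rw [hasFPowerSeriesAt_iff]
    exact Eventually.of_forall fun x => by simpa using hq x
  have h := h1.eq_formalMultilinearSeries h2
  funext n
  have := congrArg (fun r => r.coeff n) h
  simpa using this

/-- Elementary symmetric sums. -/
noncomputable def es (b : ℕ → ℂ) (n : ℕ) : ℂ := ∑' s : {s : Finset ℕ // s.card = n}, ∏ i ∈ s.1, b i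

theorem es_hasSum (b : ℕ → ℂ) (hb : Summable b) (x : ℂ) :
    HasSum (fun n => x ^ n * es b n) (∏' k, (1 + x * b k)) := by
  have hs : Summable (fun s : Finset ℕ => ∏ i ∈ s, (x * b i)) :=
    summable_finsetProd_of_summable_norm (hb.mul_left x).norm
  rw [tprod_one_add hs]
  have h1 := (Equiv.sigmaFiberEquiv (fun s : Finset ℕ => s.card)).hasSum_iff.mpr hs.hasSum
  have h2 := h1.sigma (fun n => (h1.summable.sigma_factor n).hasSum)
  convert h2 using 2 with n
  rw [es, ← tsum_mul_left]
  refine tsum_congr fun s => ?_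
  simp [Equiv.sigmaFiberEquiv, Finset.prod_mul_distrib, s.2]

theorem mzv_eq_es (z : ℕ → ℂ) (s n : ℕ) : mzv z s n = es (fun k => 1 / z k ^ s) n := by
  let φ : {f : Fin n → ℕ // StrictAnti f} → {s : Finset ℕ // s.card = n} :=
    fun f => ⟨Finset.univ.map ⟨f.1, f.2.injective⟩, by simp⟩
  have hφ : Function.Bijective φ := by
    constructor
    · intro f g h
      apply Subtype.ext
      rw [← f.2.range_inj g.2]
      have := congrArg (fun t => (t.1 : Set ℕ)) h
      simpa [φ] using this
    · rintro ⟨t, ht⟩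
      refine ⟨⟨fun i => t.orderEmbOfFin ht i.rev, fun i j hij => by simpa using hij⟩, ?_⟩
      apply Subtype.ext
      apply Finset.coe_injective
      simp only [φ, Finset.coe_map, Function.Embedding.coeFn_mk, Finset.coe_univ, Set.image_univ]
      rw [← Finset.range_orderEmbOfFin t ht]
      exact Fin.revPerm.surjective.range_comp (t.orderEmbOfFin ht)
  rw [mzv, es, ← (Equiv.ofBijective φ hφ).tsum_eq]
  refine tsum_congr fun f => ?_
  simp [φ]

open PowerSeries in
theorem coeff_rec (b : ℂ) (u : ℕ → ℂ)
    (hu : ∀ n : ℕ, ((n : ℂ) + 1) * ((n : ℂ) + 1 + b) * u (n + 1) = u n) (m : ℕ) :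
    ((m : ℂ) + 2 + b - 1) * ((m : ℂ) + 2 + 2 * b) * ((m : ℂ) + 2) * ((m : ℂ) + 2 + b) *
      coeff (m + 2) (mk u * mk (fun i => (-1) ^ i * u i)) =
    -4 * coeff m (mk u * mk (fun i => (-1) ^ i * u i)) := by
  set f : ℂ⟦X⟧ := mk u with hf
  set g : ℂ⟦X⟧ := mk (fun i => (-1) ^ i * u i) with hg
  let D : Derivation ℂ ℂ⟦X⟧ ℂ⟦X⟧ := (X : ℂ⟦X⟧) • PowerSeries.derivative ℂ
  have hDc : ∀ (p : ℂ⟦X⟧) (n : ℕ), coeff n (D p) = n * coeff n p := by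
    intro p n
    have : D p = X * PowerSeries.derivative ℂ p := rfl
    rw [this]
    cases n with
    | zero => simp
    | succ n => rw [coeff_succ_X_mul, coeff_derivative]; push_cast; ring
  have hDX : D X = X := by
    ext n; rw [hDc, coeff_X]; split_ifs with h <;> simp [h]
  have hDC : ∀ (a : ℂ) (p : ℂ⟦X⟧), D (C a * p) = C a * D p := by
    intro a p; ext n; rw [hDc, coeff_C_mul, coeff_C_mul, hDc]; ring
  have hff : D (D f) = X * f - C b * D f := by
    ext n
    simp only [hDc, map_sub, coeff_C_mul]
    cases n with
    | zero => simp
    | succ n =>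
      rw [coeff_succ_X_mul]; simp only [hf, coeff_mk]; rw [← hu n]; push_cast; ring
  have hgg : D (D g) = -(X * g) - C b * D g := by
    ext n
    simp only [hDc, map_sub, map_neg, coeff_C_mul]
    cases n with
    | zero => simp
    | succ n =>
      rw [coeff_succ_X_mul]; simp only [hg, coeff_mk]; rw [← hu n]; push_cast; ring
  have hmul : ∀ p q : ℂ⟦X⟧, D (p * q) = p * D q + q * D p := by
    intro p q; simp [Derivation.leibniz]
  have e1 : D (D (f * g)) + C b * D (f * g) = C 2 * (D f * D g) := by
    simp only [hmul, map_add, hff, hgg]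
    have : (C 2 : ℂ⟦X⟧) = 2 := map_ofNat C 2
    rw [this]; ring
  have e2 : D (C 2 * (D f * D g)) + C (2 * b) * (C 2 * (D f * D g))
      = C (-2) * (X * (D f * g - f * D g)) := by
    simp only [hDC, hmul, map_add, hff, hgg]
    have : (C 2 : ℂ⟦X⟧) = 2 := map_ofNat C 2
    rw [map_mul, map_neg, this]; ring
  have e3 : D (C (-2) * (X * (D f * g - f * D g))) + C (b - 1) * (C (-2) * (X * (D f * g - f * D g)))
      = C (-4) * ((f * g) * X ^ 2) := by
    simp only [hDC, hmul, map_add, map_sub, hff, hgg, hDX]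
    have : (C 2 : ℂ⟦X⟧) = 2 := map_ofNat C 2
    have h4 : (C 4 : ℂ⟦X⟧) = 4 := map_ofNat C 4
    rw [map_neg, map_neg, this, h4, map_one]; ring
  have c1 := congrArg (coeff (m + 2)) e1
  have c2 := congrArg (coeff (m + 2)) e2
  have c3 := congrArg (coeff (m + 2)) e3
  simp only [map_add, hDc, coeff_C_mul, coeff_mul_X_pow] at c1 c2 c3
  push_cast at c1 c2 c3
  linear_combination c3 + (↑m + 2 + b - 1) * c2 + (↑m + 2 + b - 1) * (↑m + 2 + 2 * b) * c1

theorem poch_ne_s9 (ν : ℂ) (hν : ∀ k : ℕ, ν ≠ -((k : ℂ) + 1)) (n : ℕ) : poch (ν + 1) n ≠ 0 := by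
  induction n with
  | zero => simp [poch]
  | succ n ih =>
    rw [poch_succ]
    refine mul_ne_zero ih fun h => hν n ?_
    linear_combination h

theorem alt_sum (ν : ℂ) (hν : ∀ k : ℕ, ν ≠ -((k : ℂ) + 1)) (n : ℕ) :
    ∑ p ∈ Finset.HasAntidiagonal.antidiagonal (2 * n), (1 / ((Nat.factorial p.1 : ℂ) * poch (ν + 1) p.1)) *
      ((-1) ^ p.2 * (1 / ((Nat.factorial p.2 : ℂ) * poch (ν + 1) p.2))) =
    (-1) ^ n / ((Nat.factorial n : ℂ) * poch (ν + 1) (2 * n) * poch (ν + 1) n) := by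
  have hne : ∀ k : ℕ, ν + 1 + k ≠ 0 := fun k h => hν k (by linear_combination h)
  set u : ℕ → ℂ := fun m => 1 / ((Nat.factorial m : ℂ) * poch (ν + 1) m) with hu
  have hrec : ∀ n : ℕ, ((n : ℂ) + 1) * ((n : ℂ) + 1 + ν) * u (n + 1) = u n := by
    intro n
    have h1 := poch_ne_s9 ν hν n
    have h2 := hne n
    have h3 : (n : ℂ) + 1 ≠ 0 := by exact_mod_cast Nat.succ_ne_zero n
    have h4 : (n.factorial : ℂ) ≠ 0 := by exact_mod_cast n.factorial_ne_zero
    simp only [hu, poch_succ, Nat.factorial_succ]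
    push_cast
    field_simp
    ring
  have key := coeff_rec ν u hrec
  have hc : ∀ m, ∑ p ∈ Finset.HasAntidiagonal.antidiagonal m, u p.1 * ((-1) ^ p.2 * u p.2) =
      PowerSeries.coeff m (PowerSeries.mk u * PowerSeries.mk (fun i => (-1) ^ i * u i)) := by
    intro m; simp [PowerSeries.coeff_mul]
  change ∑ p ∈ Finset.HasAntidiagonal.antidiagonal (2 * n), u p.1 * ((-1) ^ p.2 * u p.2) = _
  induction n with
  | zero => simp [hu, poch]
  | succ n ih =>
    have k := key (2 * n)
    rw [← hc, ← hc, ih] at k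
    rw [show 2 * (n + 1) = 2 * n + 2 by ring]
    rw [poch_succ _ (2 * n + 1), poch_succ _ (2 * n), poch_succ _ n, Nat.factorial_succ]
    have h1 := poch_ne_s9 ν hν n
    have h1' := poch_ne_s9 ν hν (2 * n)
    have h2 := hne n
    have h2' := hne (2 * n)
    have h2'' := hne (2 * n + 1)
    have h3 : (n : ℂ) + 1 ≠ 0 := by exact_mod_cast Nat.succ_ne_zero n
    have h4 : (n.factorial : ℂ) ≠ 0 := by exact_mod_cast n.factorial_ne_zero
    push_cast at h2 h2' h2'' k ⊢
    have hA : (4 : ℂ) * ((ν + 1 + 2 * n) * (ν + 1 + n) * (n + 1) * (ν + 1 + (2 * n + 1))) ≠ 0 := by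
      simp [*]
    apply mul_left_cancel₀ hA
    refine Eq.trans ?_ (k.trans ?_)
    · ring
    · field_simp
      ring

open Filter Topology in
theorem bessel_summable (ν : ℂ) (hν : ∀ k : ℕ, ν ≠ -((k : ℂ) + 1)) (x : ℂ) :
    Summable (fun m : ℕ => x ^ m * (1 / ((Nat.factorial m : ℂ) * poch (ν + 1) m))) := by
  have hne : ∀ k : ℕ, ν + 1 + k ≠ 0 := fun k h => hν k (by linear_combination h)
  have t1 : Tendsto (fun n : ℕ => ‖x‖ * (‖(n : ℂ) + 1‖⁻¹ * ‖ν + 1 + n‖⁻¹)) atTop (𝓝 (‖x‖ * (0 * 0))) := by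
    refine tendsto_const_nhds.mul (Tendsto.mul ?_ ?_)
    · refine tendsto_inv_atTop_zero.comp ?_
      have : Tendsto (fun n : ℕ => ((n : ℝ) + 1)) atTop atTop :=
        tendsto_atTop_add_const_right _ _ tendsto_natCast_atTop_atTop
      refine this.congr fun n => ?_
      rw [show (n : ℂ) + 1 = ((n + 1 : ℕ) : ℂ) by push_cast; ring, Complex.norm_natCast]
      push_cast; ring
    · refine tendsto_inv_atTop_zero.comp ?_
      have : Tendsto (fun n : ℕ => ((n : ℝ) + -‖ν + 1‖)) atTop atTop :=
        tendsto_atTop_add_const_right _ _ tendsto_natCast_atTop_atTop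
      refine tendsto_atTop_mono (fun n => ?_) this
      have := norm_sub_le (ν + 1 + n) (ν + 1)
      rw [add_sub_cancel_left, Complex.norm_natCast] at this
      linarith
  have t2 : ∀ᶠ n : ℕ in atTop, ‖x‖ * (‖(n : ℂ) + 1‖⁻¹ * ‖ν + 1 + n‖⁻¹) < 1 / 2 :=
    t1.eventually_lt_const (by norm_num)
  refine summable_of_ratio_norm_eventually_le (r := 1 / 2) (by norm_num) ?_
  filter_upwards [t2] with n hn
  have h1 := poch_ne_s9 ν hν n
  have h2 := hne n
  have h3 : (n : ℂ) + 1 ≠ 0 := by exact_mod_cast Nat.succ_ne_zero n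
  have h4 : (n.factorial : ℂ) ≠ 0 := by exact_mod_cast n.factorial_ne_zero
  have : x ^ (n + 1) * (1 / ((Nat.factorial (n + 1) : ℂ) * poch (ν + 1) (n + 1))) =
      (x * (((n : ℂ) + 1)⁻¹ * (ν + 1 + n)⁻¹)) * (x ^ n * (1 / ((Nat.factorial n : ℂ) * poch (ν + 1) n))) := by
    rw [poch_succ, Nat.factorial_succ]
    push_cast
    field_simp
    ring
  rw [this, norm_mul]
  refine mul_le_mul_of_nonneg_right ?_ (norm_nonneg _)
  rw [norm_mul, norm_mul, norm_inv, norm_inv]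
  exact hn.le

theorem es_sq (a : ℕ → ℂ) (ha : Summable a) (n : ℕ) :
    (-1) ^ n * es (fun k => a k ^ 2) n =
      ∑ p ∈ Finset.HasAntidiagonal.antidiagonal (2 * n), es a p.1 * ((-1) ^ p.2 * es a p.2) := by
  have ha2 : Summable (fun k => a k ^ 2) := by
    have : Summable (fun k => ‖a k‖ ^ 2) := by
      have := ha.norm
      refine this.of_norm_bounded_eventually_nat (g := fun k => ‖a k‖) ?_
      have h0 := this.tendsto_atTop_zero.eventually_le_const (u := 1) (by norm_num)
      filter_upwards [h0] with k hk
      rw [norm_pow, norm_norm, pow_two]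
      exact mul_le_of_le_one_left (norm_nonneg _) hk
    exact Summable.of_norm (by simpa using this)
  let d : ℕ → ℂ := fun m => if Even m then (-1) ^ (m / 2) * es (fun k => a k ^ 2) (m / 2) else 0
  let e : ℕ → ℂ := fun m => ∑ p ∈ Finset.HasAntidiagonal.antidiagonal m, es a p.1 * ((-1) ^ p.2 * es a p.2)
  have hd : ∀ x : ℂ, HasSum (fun m => x ^ m * d m) (∏' k, (1 + (-x ^ 2) * a k ^ 2)) := by
    intro x
    have h := es_hasSum _ ha2 (-x ^ 2)
    have hinj : Function.Injective (fun m : ℕ => 2 * m) := fun i j h => by simpa using h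
    rw [← hinj.hasSum_iff]
    · convert h using 2 with m
      simp only [Function.comp, d]
      simp
      rw [neg_pow, pow_mul]; ring
    · intro m hm
      have : ¬ Even m := by
        rintro ⟨r, rfl⟩; exact hm ⟨r, by simp; ring⟩
      simp [d, this]
  have he : ∀ x : ℂ, HasSum (fun m => x ^ m * e m) (∏' k, (1 + (-x ^ 2) * a k ^ 2)) := by
    intro x
    have h1 := es_hasSum a ha x
    have h2 := es_hasSum a ha (-x)
    have m1 : Multipliable (fun k => 1 + x * a k) :=
      multipliable_one_add_of_summable (ha.mul_left x).norm
    have m2 : Multipliable (fun k => 1 + (-x) * a k) :=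
      multipliable_one_add_of_summable (ha.mul_left (-x)).norm
    have hp : ∏' k, (1 + (-x ^ 2) * a k ^ 2) = (∏' k, (1 + x * a k)) * ∏' k, (1 + (-x) * a k) := by
      rw [← m1.tprod_mul m2]
      refine tprod_congr fun k => ?_
      ring
    rw [hp, ← h1.tsum_eq, ← h2.tsum_eq,
      tsum_mul_tsum_eq_tsum_sum_antidiagonal_of_summable_norm h1.summable.norm h2.summable.norm]
    have hs := (summable_norm_sum_mul_antidiagonal_of_summable_norm
      h1.summable.norm h2.summable.norm).of_norm.hasSum
    refine Eq.mp (congrArg (fun F : ℕ → ℂ => HasSum F _) ?_) hs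
    funext m
    symm
    change _ * ∑ p ∈ Finset.HasAntidiagonal.antidiagonal m, es a p.1 * ((-1) ^ p.2 * es a p.2) = _
    rw [Finset.mul_sum]
    refine Finset.sum_congr rfl fun p hp => ?_
    rw [← Finset.HasAntidiagonal.mem_antidiagonal.mp hp, neg_pow x, pow_add]; ring
  have := congrFun (coeff_unique d e _ hd he) (2 * n)
  simpa [d, e] using this

/-- Evaluation of the Bessel multiple zeta values `ζ_{B,ν}({4}^n)`. -/
theorem bessel_mzv_four (ν : ℂ) (hν : ∀ k : ℕ, ν ≠ -((k : ℂ) + 1))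
    (z : ℕ → ℂ) (hz : ∀ k, z k ≠ 0)
    (hsum : Summable (fun k => 1 / (z k) ^ 2))
    (hprod : ∀ t : ℂ, HasProd (fun k => 1 - t ^ 2 / (z k) ^ 2)
      (∑' m : ℕ, (-1 : ℂ) ^ m / ((Nat.factorial m : ℂ) * poch (ν + 1) m) * (t / 2) ^ (2 * m)))
    (n : ℕ) :
    mzv z 4 n = 1 / (2 ^ (4 * n) * (Nat.factorial n : ℂ) * poch (ν + 1) (2 * n) * poch (ν + 1) n) := by
  have ha : Summable (fun k => 1 / z k ^ 2) := hsum
  have hE : es (fun k => 1 / z k ^ 2) =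
      fun m => (1 / 4) ^ m * (1 / ((Nat.factorial m : ℂ) * poch (ν + 1) m)) := by
    refine coeff_unique _ _ _ (es_hasSum _ ha) fun x => ?_
    obtain ⟨t, ht⟩ := IsAlgClosed.exists_pow_nat_eq (-x) (n := 2) (by norm_num)
    have hp := (hprod t).tprod_eq
    have h1 : ∏' k, (1 + x * (1 / z k ^ 2)) = ∏' k, (1 - t ^ 2 / z k ^ 2) := by
      refine tprod_congr fun k => ?_
      rw [ht]; ring
    rw [h1, hp]
    have h2 := (bessel_summable ν hν (x / 4)).hasSum
    have h3 : ∀ m : ℕ, (-1 : ℂ) ^ m / ((Nat.factorial m : ℂ) * poch (ν + 1) m) * (t / 2) ^ (2 * m)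
        = (x / 4) ^ m * (1 / ((Nat.factorial m : ℂ) * poch (ν + 1) m)) := by
      intro m
      rw [pow_mul, div_pow, ht, show x / 4 = (-1) * (-x / 2 ^ 2) by ring, mul_pow]
      ring
    rw [tsum_congr h3]
    convert h2 using 2 with m
    rw [div_pow, div_pow]; ring
  have hs := es_sq _ ha n
  rw [hE] at hs
  have h4 : (fun k => (1 / z k ^ 2) ^ 2) = fun k => 1 / z k ^ 4 := by
    funext k; rw [div_pow, one_pow, ← pow_mul]
  rw [h4, ← mzv_eq_es] at hs
  have h5 : ∑ p ∈ Finset.HasAntidiagonal.antidiagonal (2 * n),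
      (1 / 4 : ℂ) ^ p.1 * (1 / ((Nat.factorial p.1 : ℂ) * poch (ν + 1) p.1)) *
      ((-1) ^ p.2 * ((1 / 4) ^ p.2 * (1 / ((Nat.factorial p.2 : ℂ) * poch (ν + 1) p.2)))) =
      (1 / 4) ^ (2 * n) *
        ((-1) ^ n / ((Nat.factorial n : ℂ) * poch (ν + 1) (2 * n) * poch (ν + 1) n)) := by
    rw [← alt_sum ν hν n, Finset.mul_sum]
    refine Finset.sum_congr rfl fun p hp => ?_
    rw [← Finset.HasAntidiagonal.mem_antidiagonal.mp hp, pow_add]; ring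
  have h6 : ((-1 : ℂ) ^ n) ≠ 0 := pow_ne_zero _ (by norm_num)
  apply mul_left_cancel₀ h6
  rw [hs]
  refine h5.trans ?_
  have h7 : (2 : ℂ) ^ (4 * n) = 4 ^ (2 * n) := by
    rw [pow_mul, pow_mul]; norm_num
  rw [h7, one_div, inv_pow]
  simp only [div_eq_mul_inv, mul_inv]
  ring
end
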